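/- arXiv:2310.05741 — 8 statements merged into one kernel-verified Lean document; each statement's English description precedes it below -/
import Mathlib

section
/- Generalized fictitious play convergence (core convergence mechanism of Theorem 3.1). Under the fictitious-play hypotheses, if m* ∈ E is a cluster point of the sequence (m̄_n), i.e. the limit in norm of some subsequence of (m̄_n), then ⟨f(m*), m − m*⟩ ≥ 0 for every m ∈ T. -/
open scoped RealInnerProductSpace

theorem fp_descent {E : Type*} [NormedAddCommGroup E] [InnerProductSpace ℝ E]
    (L : ℝ) (hL : 0 < L) (f : E → E) (Φ : E → ℝ)
    (hgrad : ∀ x : E, ∃ φ : E →L[ℝ] ℝ, HasFDerivAt Φ φ x ∧ ∀ v : E, φ v = ⟪f x, v⟫)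
    (hLip : ∀ x y : E, ‖f x - f y‖ ≤ L * ‖x - y‖) (x y : E) :
    |Φ y - Φ x - ⟪f x, y - x⟫| ≤ L * ‖y - x‖ ^ 2 := by
  choose φ hφ hφv using hgrad
  have h := (convex_closedBall x ‖y - x‖).norm_image_sub_le_of_norm_hasFDerivWithin_le
    (f := fun z => Φ z - innerSL ℝ (f x) z) (f' := fun z => φ z - innerSL ℝ (f x))
    (C := L * ‖y - x‖) (x := x) (y := y)
    (fun z _ => ((hφ z).sub (innerSL ℝ (f x)).hasFDerivAt).hasFDerivWithinAt)
    (fun z hz => by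
      refine ContinuousLinearMap.opNorm_le_bound _ (by positivity) fun v => ?_
      have h1 : (φ z - innerSL ℝ (f x)) v = ⟪f z - f x, v⟫ := by
        simp [hφv, inner_sub_left]
      rw [h1]
      refine (norm_inner_le_norm _ _).trans ?_
      gcongr
      refine (hLip z x).trans ?_
      gcongr
      simpa [dist_eq_norm] using hz)
    (by simp) (by simp [dist_eq_norm])
  have e : Φ y - Φ x - ⟪f x, y - x⟫ = (Φ y - innerSL ℝ (f x) y) - (Φ x - innerSL ℝ (f x) x) := by
    simp [inner_sub_right]; ring
  rw [e, pow_two, ← mul_assoc]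
  exact h

theorem fp_tail (a : ℕ → ℝ) (ha : ∀ n, 0 ≤ a n) (hs : Summable a) (η : ℝ) (hη : 0 < η) :
    ∃ N, ∀ n ≥ N, ∀ k, ∑ i ∈ Finset.range k, a (n + i) < η := by
  have h := hs.hasSum.tendsto_sum_nat.eventually (lt_mem_nhds (sub_lt_self (∑' i, a i) hη))
  obtain ⟨N, hN⟩ := Filter.eventually_atTop.1 h
  refine ⟨N, fun n hn k => ?_⟩
  have h1 := hN n hn
  have h2 := hs.sum_le_tsum (Finset.range (n + k)) (fun i _ => ha i)
  rw [Finset.sum_range_add] at h2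
  linarith

/-- Generalized fictitious play convergence (core convergence mechanism of Theorem 3.1 of
"A Fictitious Play Approach to Mean Field Games with Optimal Stopping").
Under the fictitious-play hypotheses, any cluster point `m*` of the sequence of updated
distributions `m̄_n` satisfies the variational inequality `⟨f(m*), m − m*⟩ ≥ 0` for all `m ∈ T`. -/
theorem fictitious_play_cluster_point_variational_inequality
    {E : Type*} [NormedAddCommGroup E] [InnerProductSpace ℝ E]
    (C L : ℝ) (hC : 0 < C) (hL : 0 < L)
    (T : Set E) (hTne : T.Nonempty) (hTconv : Convex ℝ T)
    (hTbd : ∀ x ∈ T, ∀ y ∈ T, ‖x - y‖ ≤ C)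
    (f : E → E) (Φ : E → ℝ)
    (hgrad : ∀ x : E, ∃ φ : E →L[ℝ] ℝ, HasFDerivAt Φ φ x ∧ ∀ v : E, φ v = ⟪f x, v⟫)
    (hLip : ∀ x y : E, ‖f x - f y‖ ≤ L * ‖x - y‖)
    (δ : ℕ → ℝ)
    (hδpos : ∀ n : ℕ, 0 < δ (n + 1)) (hδle : ∀ n : ℕ, δ (n + 1) ≤ 1)
    (hδdiv : ¬ Summable (fun n : ℕ => δ (n + 1)))
    (hδsq : Summable (fun n : ℕ => δ (n + 1) ^ 2))
    (m mbar : ℕ → E)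
    (hm : ∀ n : ℕ, m (n + 1) ∈ T)
    (hmbar0 : mbar 0 ∈ T)
    (hrec : ∀ n : ℕ, mbar (n + 1) = δ (n + 1) • m (n + 1) + (1 - δ (n + 1)) • mbar n)
    (hbr : ∀ n : ℕ, ∀ x ∈ T, ⟪f (mbar n), m (n + 1) - x⟫ ≤ 0)
    (mstar : E)
    (hcluster : ∃ φ : ℕ → ℕ, StrictMono φ ∧
      Filter.Tendsto (fun k => mbar (φ k)) Filter.atTop (nhds mstar)) :
    ∀ x ∈ T, 0 ≤ ⟪f mstar, x - mstar⟫ := by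
  intro x hx
  by_contra! hneg
  have hT : ∀ n, mbar n ∈ T := by
    intro n
    induction n with
    | zero => exact hmbar0
    | succ n ih =>
      rw [hrec]
      exact hTconv (hm n) ih (hδpos n).le (by linarith [hδle n]) (by ring)
  have hstep : ∀ n, mbar (n + 1) - mbar n = δ (n + 1) • (m (n + 1) - mbar n) := by
    intro n
    rw [hrec]; module
  have hstepn : ∀ n, ‖mbar (n + 1) - mbar n‖ ≤ δ (n + 1) * C := by
    intro n
    rw [hstep, norm_smul, Real.norm_of_nonneg (hδpos n).le]
    exact mul_le_mul_of_nonneg_left (hTbd _ (hm n) _ (hT n)) (hδpos n).le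
  have hdes := fp_descent L hL f Φ hgrad hLip
  set e : ℕ → ℝ := fun n => ⟪f (mbar n), mbar n - m (n + 1)⟫ with he
  have hex : ∀ n, ∀ y ∈ T, ⟪f (mbar n), mbar n - y⟫ ≤ e n := by
    intro n y hy
    have := hbr n y hy
    simp only [he, inner_sub_right] at this ⊢
    linarith
  have he0 : ∀ n, 0 ≤ e n := fun n => by simpa using hex n _ (hT n)
  have hdec : ∀ n, δ (n + 1) * e n ≤ Φ (mbar n) - Φ (mbar (n + 1)) + L * C ^ 2 * δ (n + 1) ^ 2 := by
    intro n
    have h1 := (abs_le.1 (hdes (mbar n) (mbar (n + 1)))).2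
    have h2 : ⟪f (mbar n), mbar (n + 1) - mbar n⟫ = - (δ (n + 1) * e n) := by
      rw [hstep, inner_smul_right]
      simp only [he, inner_sub_right]; ring
    have h3 : L * ‖mbar (n + 1) - mbar n‖ ^ 2 ≤ L * (δ (n + 1) * C) ^ 2 := by
      gcongr
      exact hstepn n
    rw [h2] at h1
    nlinarith
  have hsum : ∀ n, ∑ i ∈ Finset.range n, δ (i + 1) * e i ≤
      Φ (mbar 0) - Φ (mbar n) + L * C ^ 2 * ∑ i ∈ Finset.range n, δ (i + 1) ^ 2 := by
    intro n
    induction n with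
    | zero => simp
    | succ n ih =>
      rw [Finset.sum_range_succ, Finset.sum_range_succ, mul_add]
      linarith [hdec n]
  have hlow : ∀ n, Φ (mbar 0) - Φ (mbar n) ≤ ‖f (mbar 0)‖ * C + L * C ^ 2 := by
    intro n
    have h1 := (abs_le.1 (hdes (mbar 0) (mbar n))).1
    have hb := hTbd _ (hT n) _ (hT 0)
    have h2 := (abs_le.1 (abs_real_inner_le_norm (f (mbar 0)) (mbar n - mbar 0))).1
    have h3 : L * ‖mbar n - mbar 0‖ ^ 2 ≤ L * C ^ 2 := by gcongr
    have h4 : ‖f (mbar 0)‖ * ‖mbar n - mbar 0‖ ≤ ‖f (mbar 0)‖ * C := by gcongr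
    linarith
  have hpos : ∀ n, 0 ≤ δ (n + 1) * e n := fun n => mul_nonneg (hδpos n).le (he0 n)
  have hS : Summable (fun n => δ (n + 1) * e n) := by
    refine summable_of_sum_range_le
      (c := ‖f (mbar 0)‖ * C + L * C ^ 2 + L * C ^ 2 * ∑' i, δ (i + 1) ^ 2) hpos fun n => ?_
    have h1 := hδsq.sum_le_tsum (Finset.range n) (fun i _ => sq_nonneg _)
    have h2 := mul_le_mul_of_nonneg_left h1 (by positivity : 0 ≤ L * C ^ 2)
    linarith [hsum n, hlow n]
  have hfc : Continuous f := by
    refine (LipschitzWith.of_dist_le_mul (K := ⟨L, hL.le⟩) fun a b => ?_).continuous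
    rw [dist_eq_norm, dist_eq_norm]; exact hLip a b
  have hgc : Continuous (fun z => ⟪f z, z - x⟫) := by fun_prop
  obtain ⟨ε, hε, hεlt⟩ : ∃ ε, 0 < ε ∧ ε < ⟪f mstar, mstar - x⟫ := by
    apply exists_between
    simp only [inner_sub_right] at hneg ⊢
    linarith
  obtain ⟨r, hr, hball⟩ := Metric.eventually_nhds_iff.1
    (hgc.continuousAt.eventually (lt_mem_nhds hεlt))
  obtain ⟨N, hN⟩ := fp_tail _ hpos hS (ε * (r / (2 * C))) (by positivity)
  obtain ⟨φ, hφ, hlim⟩ := hcluster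
  obtain ⟨k, hk1, hk2⟩ := ((Metric.tendsto_nhds.1 hlim (r / 2) (by positivity)).and
    (Filter.eventually_ge_atTop N)).exists
  set p := φ k with hp
  have hpN : p ≥ N := hk2.trans (hφ.le_apply)
  have hdist : ∀ j, dist (mbar (p + j)) mstar ≤
      dist (mbar p) mstar + C * ∑ i ∈ Finset.range j, δ (p + i + 1) := by
    intro j
    induction j with
    | zero => simp
    | succ j ih =>
      have h1 := dist_triangle (mbar (p + j + 1)) (mbar (p + j)) mstar
      have h2 := hstepn (p + j)
      rw [← dist_eq_norm] at h2
      rw [Finset.sum_range_succ, ← add_assoc]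
      linarith
  have hbd : ∀ j, ε * ∑ i ∈ Finset.range j, δ (p + i + 1) ≤
      ∑ i ∈ Finset.range j, δ (p + i + 1) * e (p + i) := by
    intro j
    induction j with
    | zero => simp
    | succ j ih =>
      have h1 : ∑ i ∈ Finset.range j, δ (p + i + 1) < r / (2 * C) :=
        lt_of_mul_lt_mul_left (ih.trans_lt (hN p hpN j)) hε.le
      have h2 := mul_lt_mul_of_pos_left h1 hC
      have h3 : C * (r / (2 * C)) = r / 2 := by field_simp
      have h4 := hball (y := mbar (p + j)) (by linarith [hdist j])
      have h5 := mul_le_mul_of_nonneg_left (h4.le.trans (hex (p + j) x hx)) (hδpos (p + j)).le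
      rw [Finset.sum_range_succ, Finset.sum_range_succ, mul_add]
      linarith
  apply hδdiv
  rw [← summable_nat_add_iff p]
  refine summable_of_sum_range_le (c := r / (2 * C)) (fun n => (hδpos _).le) fun n => ?_
  have h1 := lt_of_mul_lt_mul_left ((hbd n).trans_lt (hN p hpN n)) hε.le
  simp only [add_comm _ p]
  exact h1.le
end

section
/- Approximate decrease of the potential along generalized fictitious play. Under the fictitious-play hypotheses, for every n ≥ 0 one has Φ(m̄_{n+1}) − Φ(m̄_n) ≤ δ_{n+1} ⟨f(m̄_n), m_{n+1} − m̄_n⟩ + L C² δ_{n+1}², and moreover Φ(m̄_{n+1}) − Φ(m̄_n) ≤ L C² δ_{n+1}². Consequently, for all natural numbers N ≤ n, Φ(m̄_n) ≤ Φ(m̄_N) + L C² Σ_{k=N+1}^{∞} δ_k². -/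
open scoped RealInnerProductSpace

/-- Approximate decrease of the potential along generalized fictitious play: under the
fictitious-play hypotheses, `Φ(m̄_{n+1}) − Φ(m̄_n) ≤ δ_{n+1}⟨f(m̄_n), m_{n+1} − m̄_n⟩ + LC²δ_{n+1}²`,
hence `Φ(m̄_{n+1}) − Φ(m̄_n) ≤ LC²δ_{n+1}²`, and consequently for `N ≤ n`,
`Φ(m̄_n) ≤ Φ(m̄_N) + LC² Σ_{k=N+1}^∞ δ_k²`. -/
theorem fictitious_play_potential_approximate_decrease
    {E : Type*} [NormedAddCommGroup E] [InnerProductSpace ℝ E]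
    (C L : ℝ) (hC : 0 < C) (hL : 0 < L)
    (T : Set E) (hTne : T.Nonempty) (hTconv : Convex ℝ T)
    (hTbd : ∀ x ∈ T, ∀ y ∈ T, ‖x - y‖ ≤ C)
    (f : E → E) (Φ : E → ℝ)
    (hgrad : ∀ x : E, ∃ φ : E →L[ℝ] ℝ, HasFDerivAt Φ φ x ∧ ∀ v : E, φ v = ⟪f x, v⟫)
    (hLip : ∀ x y : E, ‖f x - f y‖ ≤ L * ‖x - y‖)
    (δ : ℕ → ℝ)
    (hδpos : ∀ n : ℕ, 0 < δ (n + 1)) (hδle : ∀ n : ℕ, δ (n + 1) ≤ 1)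
    (hδdiv : ¬ Summable (fun n : ℕ => δ (n + 1)))
    (hδsq : Summable (fun n : ℕ => δ (n + 1) ^ 2))
    (m mbar : ℕ → E)
    (hm : ∀ n : ℕ, m (n + 1) ∈ T)
    (hmbar0 : mbar 0 ∈ T)
    (hrec : ∀ n : ℕ, mbar (n + 1) = δ (n + 1) • m (n + 1) + (1 - δ (n + 1)) • mbar n)
    (hbr : ∀ n : ℕ, ∀ x ∈ T, ⟪f (mbar n), m (n + 1) - x⟫ ≤ 0) :
    (∀ n : ℕ, Φ (mbar (n + 1)) - Φ (mbar n) ≤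
        δ (n + 1) * ⟪f (mbar n), m (n + 1) - mbar n⟫ + L * C ^ 2 * δ (n + 1) ^ 2) ∧
    (∀ n : ℕ, Φ (mbar (n + 1)) - Φ (mbar n) ≤ L * C ^ 2 * δ (n + 1) ^ 2) ∧
    (∀ N n : ℕ, N ≤ n →
        Φ (mbar n) ≤ Φ (mbar N) + L * C ^ 2 * ∑' i : ℕ, δ (N + 1 + i) ^ 2) := by
  have hT : ∀ n, mbar n ∈ T := by
    intro n
    induction n with
    | zero => exact hmbar0
    | succ k ih =>
      rw [hrec]
      exact hTconv (hm k) ih (hδpos k).le (by linarith [hδle k]) (by ring)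
  have hdesc : ∀ x v : E, Φ (x + v) - Φ x ≤ ⟪f x, v⟫ + L * ‖v‖ ^ 2 := by
    intro x v
    have hd : ∀ t : ℝ, HasDerivAt (fun t : ℝ => Φ (x + t • v)) ⟪f (x + t • v), v⟫ t := by
      intro t
      obtain ⟨φ, hφ, hv⟩ := hgrad (x + t • v)
      have h1 : HasDerivAt (fun t : ℝ => x + t • v) v t := by
        simpa using ((hasDerivAt_id t).smul_const v).const_add x
      have h2 := hφ.comp_hasDerivAt t h1
      rw [hv] at h2
      exact h2
    obtain ⟨c, hc, he⟩ := exists_hasDerivAt_eq_slope (fun t : ℝ => Φ (x + t • v))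
      (fun t => ⟪f (x + t • v), v⟫) zero_lt_one
      (fun t _ => (hd t).continuousAt.continuousWithinAt) (fun t _ => hd t)
    simp only [one_smul, zero_smul, add_zero, sub_zero, div_one] at he
    rw [← he]
    have h3 : ⟪f (x + c • v), v⟫ = ⟪f x, v⟫ + ⟪f (x + c • v) - f x, v⟫ := by
      rw [inner_sub_left]; ring
    have h4 := real_inner_le_norm (f (x + c • v) - f x) v
    have h5 := hLip (x + c • v) x
    rw [add_sub_cancel_left, norm_smul, Real.norm_eq_abs, abs_of_pos hc.1] at h5
    have h6 : c * ‖v‖ ≤ ‖v‖ := mul_le_of_le_one_left (norm_nonneg v) hc.2.le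
    have h7 : ‖f (x + c • v) - f x‖ ≤ L * ‖v‖ :=
      h5.trans (mul_le_mul_of_nonneg_left h6 hL.le)
    have h8 := mul_le_mul_of_nonneg_right h7 (norm_nonneg v)
    rw [h3]
    nlinarith
  have A : ∀ n : ℕ, Φ (mbar (n + 1)) - Φ (mbar n) ≤
        δ (n + 1) * ⟪f (mbar n), m (n + 1) - mbar n⟫ + L * C ^ 2 * δ (n + 1) ^ 2 := by
    intro n
    have h := hdesc (mbar n) (δ (n + 1) • (m (n + 1) - mbar n))
    have e : mbar n + δ (n + 1) • (m (n + 1) - mbar n) = mbar (n + 1) := by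
      rw [hrec]; module
    rw [e, real_inner_smul_right, norm_smul, Real.norm_eq_abs, abs_of_pos (hδpos n),
      mul_pow] at h
    have h1 : ‖m (n + 1) - mbar n‖ ^ 2 ≤ C ^ 2 :=
      pow_le_pow_left₀ (norm_nonneg _) (hTbd _ (hm n) _ (hT n)) 2
    have h2 := mul_le_mul_of_nonneg_left h1
      (mul_nonneg hL.le (sq_nonneg (δ (n + 1))))
    linarith
  have B : ∀ n : ℕ, Φ (mbar (n + 1)) - Φ (mbar n) ≤ L * C ^ 2 * δ (n + 1) ^ 2 := by
    intro n
    have h := mul_nonpos_of_nonneg_of_nonpos (hδpos n).le (hbr n _ (hT n))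
    linarith [A n]
  refine ⟨A, B, ?_⟩
  intro N n hNn
  obtain ⟨k, rfl⟩ := Nat.exists_eq_add_of_le hNn
  have D : ∀ k, Φ (mbar (N + k)) ≤
      Φ (mbar N) + L * C ^ 2 * ∑ i ∈ Finset.range k, δ (N + 1 + i) ^ 2 := by
    intro k
    induction k with
    | zero => simp
    | succ k ih =>
      have h := B (N + k)
      rw [Finset.sum_range_succ, mul_add]
      have e : N + 1 + k = N + k + 1 := by omega
      rw [e, ← add_assoc N k 1]
      linarith
  have hs : Summable (fun i : ℕ => δ (N + 1 + i) ^ 2) := by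
    have h := (summable_nat_add_iff N).2 hδsq
    refine h.congr fun i => ?_
    rw [show i + N + 1 = N + 1 + i by omega]
  have h1 := hs.sum_le_tsum (Finset.range k) (fun i _ => sq_nonneg _)
  have h2 := mul_le_mul_of_nonneg_left h1 (mul_nonneg hL.le (sq_nonneg C))
  linarith [D k]
end

section
/- Best response to a cluster point has equal linearized cost (Step 3 of Theorem 3.1). Under the fictitious-play hypotheses, let m* ∈ E be a cluster point of the sequence (m̄_n), i.e. the limit in norm of some subsequence, and let m** ∈ T satisfy ⟨f(m*), m** − m⟩ ≤ 0 for every m ∈ T. Then ⟨f(m*), m** − m*⟩ = 0. -/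
open scoped RealInnerProductSpace

/-- Best response to a cluster point has equal linearized cost (Step 3 of Theorem 3.1):
if `m*` is a cluster point of `(m̄_n)` and `m** ∈ T` satisfies `⟨f(m*), m** − m⟩ ≤ 0` for all
`m ∈ T`, then `⟨f(m*), m** − m*⟩ = 0`. -/
theorem fictitious_play_best_response_equal_linearized_cost
    {E : Type*} [NormedAddCommGroup E] [InnerProductSpace ℝ E]
    (C L : ℝ) (hC : 0 < C) (hL : 0 < L)
    (T : Set E) (hTne : T.Nonempty) (hTconv : Convex ℝ T)
    (hTbd : ∀ x ∈ T, ∀ y ∈ T, ‖x - y‖ ≤ C)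
    (f : E → E) (Φ : E → ℝ)
    (hgrad : ∀ x : E, ∃ φ : E →L[ℝ] ℝ, HasFDerivAt Φ φ x ∧ ∀ v : E, φ v = ⟪f x, v⟫)
    (hLip : ∀ x y : E, ‖f x - f y‖ ≤ L * ‖x - y‖)
    (δ : ℕ → ℝ)
    (hδpos : ∀ n : ℕ, 0 < δ (n + 1)) (hδle : ∀ n : ℕ, δ (n + 1) ≤ 1)
    (hδdiv : ¬ Summable (fun n : ℕ => δ (n + 1)))
    (hδsq : Summable (fun n : ℕ => δ (n + 1) ^ 2))
    (m mbar : ℕ → E)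
    (hm : ∀ n : ℕ, m (n + 1) ∈ T)
    (hmbar0 : mbar 0 ∈ T)
    (hrec : ∀ n : ℕ, mbar (n + 1) = δ (n + 1) • m (n + 1) + (1 - δ (n + 1)) • mbar n)
    (hbr : ∀ n : ℕ, ∀ x ∈ T, ⟪f (mbar n), m (n + 1) - x⟫ ≤ 0)
    (mstar : E)
    (hcluster : ∃ φ : ℕ → ℕ, StrictMono φ ∧
      Filter.Tendsto (fun k => mbar (φ k)) Filter.atTop (nhds mstar))
    (mstarstar : E) (hmss : mstarstar ∈ T)
    (hssbr : ∀ x ∈ T, ⟪f mstar, mstarstar - x⟫ ≤ 0) :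
    ⟪f mstar, mstarstar - mstar⟫ = 0 := by
  have hmem : ∀ n, mbar n ∈ T := by
    intro n
    induction n with
    | zero => exact hmbar0
    | succ n ih =>
      rw [hrec n]
      exact hTconv (hm n) ih (hδpos n).le (by linarith [hδle n]) (by ring)
  have hfd : ∀ x, HasFDerivAt Φ (innerSL ℝ (f x)) x := by
    intro x
    obtain ⟨φ, h1, h2⟩ := hgrad x
    have : φ = innerSL ℝ (f x) := by
      ext v
      simp [h2 v]
    rwa [this] at h1
  have hdesc : ∀ x y, Φ y - Φ x ≤ ⟪f x, y - x⟫ + L * ‖y - x‖ ^ 2 := by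
    intro x y
    have h := (convex_segment (𝕜 := ℝ) x y).norm_image_sub_le_of_norm_hasFDerivWithin_le'
      (f := Φ) (f' := fun z => innerSL ℝ (f z)) (φ := innerSL ℝ (f x)) (C := L * ‖y - x‖)
      (fun z _ => (hfd z).hasFDerivWithinAt)
      (fun z hz => by
        rw [← map_sub, innerSL_apply_norm]
        refine (hLip z x).trans ?_
        gcongr
        exact norm_sub_le_of_mem_segment hz)
      (left_mem_segment ℝ x y) (right_mem_segment ℝ x y)
    have h2 := (abs_le.1 (Real.norm_eq_abs _ ▸ h)).2
    simp only [innerSL_apply_apply] at h2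
    nlinarith
  have hstep : ∀ n, mbar (n + 1) - mbar n = δ (n + 1) • (m (n + 1) - mbar n) := by
    intro n
    rw [hrec n]
    module
  have hstepn : ∀ n, ‖mbar (n + 1) - mbar n‖ ≤ δ (n + 1) * C := by
    intro n
    rw [hstep n, norm_smul, Real.norm_eq_abs, abs_of_pos (hδpos n)]
    exact mul_le_mul_of_nonneg_left (hTbd _ (hm n) _ (hmem n)) (hδpos n).le
  set g : ℕ → ℝ := fun n => - ⟪f (mbar n), m (n + 1) - mbar n⟫ with hg
  have hg0 : ∀ n, 0 ≤ g n := fun n => by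
    have := hbr n _ (hmem n)
    simp only [hg]
    linarith
  have hPhi : ∀ n, Φ (mbar (n + 1)) ≤ Φ (mbar n) - δ (n + 1) * g n + L * C ^ 2 * δ (n + 1) ^ 2 := by
    intro n
    have h := hdesc (mbar n) (mbar (n + 1))
    have h1 : ⟪f (mbar n), mbar (n + 1) - mbar n⟫ = - (δ (n + 1) * g n) := by
      rw [hstep n, inner_smul_right]
      simp only [hg]
      ring
    have h2 : ‖mbar (n + 1) - mbar n‖ ^ 2 ≤ (δ (n + 1) * C) ^ 2 :=
      pow_le_pow_left₀ (norm_nonneg _) (hstepn n) 2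
    have h3 := mul_le_mul_of_nonneg_left h2 hL.le
    rw [h1] at h
    nlinarith
  have hPhiSum : ∀ n, ∑ i ∈ Finset.range n, δ (i + 1) * g i
      ≤ Φ (mbar 0) - Φ (mbar n) + L * C ^ 2 * ∑ i ∈ Finset.range n, δ (i + 1) ^ 2 := by
    intro n
    induction n with
    | zero => simp
    | succ n ih =>
      rw [Finset.sum_range_succ, Finset.sum_range_succ]
      have := hPhi n
      linarith
  obtain ⟨φ, hφ, hlim⟩ := hcluster
  have hfc : Continuous f := by
    have : LipschitzWith (Real.toNNReal L) f := LipschitzWith.of_dist_le_mul (fun x y => by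
      rw [dist_eq_norm, dist_eq_norm, Real.coe_toNNReal _ hL.le]
      exact hLip x y)
    exact this.continuous
  have hΦlim : Filter.Tendsto (fun k => Φ (mbar (φ k))) Filter.atTop (nhds (Φ mstar)) :=
    (hfd mstar).continuousAt.tendsto.comp hlim
  have hterm : ∀ n, 0 ≤ δ (n + 1) * g n := fun n => mul_nonneg (hδpos n).le (hg0 n)
  have hsum : Summable (fun n => δ (n + 1) * g n) := by
    obtain ⟨B, hB⟩ := hΦlim.bddBelow_range
    refine summable_of_sum_range_le
      (c := Φ (mbar 0) - B + L * C ^ 2 * ∑' i, δ (i + 1) ^ 2) hterm (fun n => ?_)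
    have h1 : ∑ i ∈ Finset.range n, δ (i + 1) * g i
        ≤ ∑ i ∈ Finset.range (φ n), δ (i + 1) * g i :=
      Finset.sum_le_sum_of_subset_of_nonneg
        (Finset.range_mono (hφ.le_apply)) (fun i _ _ => hterm i)
    have h2 := hPhiSum (φ n)
    have h3 : B ≤ Φ (mbar (φ n)) := hB ⟨n, rfl⟩
    have h4 := hδsq.sum_le_tsum (Finset.range (φ n)) (fun i _ => sq_nonneg _)
    have h5 := mul_le_mul_of_nonneg_left h4 (by positivity : 0 ≤ L * C ^ 2)
    linarith
  refine le_antisymm ?_ ?_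
  · have hc : Filter.Tendsto (fun k => ⟪f mstar, mstarstar - mbar (φ k)⟫) Filter.atTop
        (nhds ⟪f mstar, mstarstar - mstar⟫) :=
      tendsto_const_nhds.inner (tendsto_const_nhds.sub hlim)
    exact le_of_tendsto' hc (fun k => hssbr _ (hmem _))
  by_contra hneg
  push Not at hneg
  obtain ⟨a, ha⟩ : ∃ a, a = - ⟪f mstar, mstarstar - mstar⟫ := ⟨_, rfl⟩
  have hapos : 0 < a := by linarith
  have hcont : Continuous (fun x => - ⟪f x, mstarstar - x⟫) := by fun_prop
  have hev : ∀ᶠ x in nhds mstar, a / 2 < - ⟪f x, mstarstar - x⟫ :=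
    hcont.continuousAt.eventually_const_lt (by simp only []; linarith)
  obtain ⟨r, hr, hball⟩ := Metric.eventually_nhds_iff.1 hev
  have htail := tendsto_sum_nat_add (fun n => δ (n + 1) * g n)
  have hη : 0 < a / 2 * (r / 2 / C) := by positivity
  have e1 := (htail.comp hφ.tendsto_atTop).eventually_lt_const hη
  have e2 := hlim.eventually (Metric.ball_mem_nhds mstar (half_pos hr))
  obtain ⟨k, hk1, hk2⟩ := (e1.and e2).exists
  simp only [Function.comp] at hk1
  obtain ⟨n, hn⟩ : ∃ n, n = φ k := ⟨_, rfl⟩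
  rw [← hn] at hk1 hk2
  have hk2 : dist (mbar n) mstar < r / 2 := hk2
  have hsumn : Summable (fun i => δ (i + n + 1) * g (i + n)) :=
    (summable_nat_add_iff (f := fun n => δ (n + 1) * g n) n).2 hsum
  have key : ∀ j, dist (mbar (j + n)) mstar < r / 2 + C * ∑ i ∈ Finset.range j, δ (i + n + 1) ∧
      a / 2 * ∑ i ∈ Finset.range j, δ (i + n + 1)
        ≤ ∑ i ∈ Finset.range j, δ (i + n + 1) * g (i + n) := by
    intro j
    induction j with
    | zero => simpa using hk2
    | succ j ih =>
      obtain ⟨h1, h2⟩ := ih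
      have h3 := hsumn.sum_le_tsum (Finset.range j) (fun i _ => hterm (i + n))
      have h4 : ∑ i ∈ Finset.range j, δ (i + n + 1) < r / 2 / C :=
        lt_of_mul_lt_mul_left (lt_of_le_of_lt (h2.trans h3) hk1) (by positivity)
      rw [lt_div_iff₀ hC] at h4
      have h5 := hball (show dist (mbar (j + n)) mstar < r by linarith)
      have h6 : a / 2 ≤ g (j + n) := by
        have := hbr (j + n) mstarstar hmss
        simp only [hg]
        have h7 : m (j + n + 1) - mbar (j + n)
          = (m (j + n + 1) - mstarstar) + (mstarstar - mbar (j + n)) := by abel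
        rw [h7, inner_add_right]
        linarith
      have h8 := mul_le_mul_of_nonneg_left h6 (hδpos (j + n)).le
      rw [Finset.sum_range_succ, Finset.sum_range_succ]
      refine ⟨?_, by linarith⟩
      have h9 := hstepn (j + n)
      rw [← dist_eq_norm] at h9
      have h10 := dist_triangle (mbar (j + n + 1)) (mbar (j + n)) mstar
      rw [show j + 1 + n = j + n + 1 by ring]
      linarith
  apply hδdiv
  rw [← summable_nat_add_iff n]
  refine summable_of_sum_range_le (c := r / 2 / C) (fun i => (hδpos (i + n)).le) (fun j => ?_)
  have h3 := hsumn.sum_le_tsum (Finset.range j) (fun i _ => hterm (i + n))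
  exact (lt_of_mul_lt_mul_left (lt_of_le_of_lt ((key j).2.trans h3) hk1) (by positivity)).le
end

section
/- Continuous dependence of the implicit discrete obstacle problem on the source term (Lemma 3.1). Let u solve the implicit discrete obstacle problem with source f. Then for every ε > 0 there exists δ > 0 such that whenever f' : {0,...,K−1} × Ω_h → ℝ and u' solves the implicit discrete obstacle problem with source f' and max_{k,j} |f'^k_j − f^k_j| < δ, one has max_{k,j} |u'^k_j − u^k_j| < ε. -/
/-- `j` is a grid point of `Ω_h = {0,…,N}^d`. -/
def isGridPt (N : ℕ) {d : ℕ} (j : Fin d → ℤ) : Prop :=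
  ∀ i : Fin d, 0 ≤ j i ∧ j i ≤ (N : ℤ)

/-- `j` is an interior grid point: every coordinate lies in `{1,…,N−1}`. -/
def isInterior (N : ℕ) {d : ℕ} (j : Fin d → ℤ) : Prop :=
  ∀ i : Fin d, 1 ≤ j i ∧ j i ≤ (N : ℤ) - 1

/-- `j` is a boundary point of the grid. -/
def isBoundary (N : ℕ) {d : ℕ} (j : Fin d → ℤ) : Prop :=
  isGridPt N j ∧ ¬ isInterior N j

/-- The finite set of interior grid points. -/
noncomputable def intPts (N d : ℕ) : Finset (Fin d → ℤ) :=
  Fintype.piFinset fun _ : Fin d => Finset.Icc (1 : ℤ) ((N : ℤ) - 1)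

/-- Discrete Laplacian with mesh size `h`:
`Δ_h v (j) = h⁻² Σᵢ (v(j+eᵢ) − 2v(j) + v(j−eᵢ))`. -/
noncomputable def discLap (h : ℝ) {d : ℕ} (v : (Fin d → ℤ) → ℝ) (j : Fin d → ℤ) : ℝ :=
  (1 / h ^ 2) * ∑ i : Fin d, (v (j + Pi.single i 1) - 2 * v j + v (j - Pi.single i 1))

/-- `u` solves the implicit discrete obstacle problem with source `f`:
`max((u^k_j − u^{k+1}_j)/τ − Δ_h u^k(j) − f^k_j, u^k_j) = 0` at interior points for `k < K`,
with `u^K = 0` on the grid and `u^k = 0` on the boundary. -/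
def solvesObstacle (N K : ℕ) (τ h : ℝ) {d : ℕ}
    (f : ℕ → (Fin d → ℤ) → ℝ) (u : ℕ → (Fin d → ℤ) → ℝ) : Prop :=
  (∀ k < K, ∀ j : Fin d → ℤ, isInterior N j →
      max ((u k j - u (k + 1) j) / τ - discLap h (u k) j - f k j) (u k j) = 0) ∧
  (∀ j : Fin d → ℤ, isGridPt N j → u K j = 0) ∧
  (∀ k < K, ∀ j : Fin d → ℤ, isBoundary N j → u k j = 0)

/-- Membership in the discrete test set `T_{h,τ}` with initial datum `m⁰`. -/
def inTestSet (N K : ℕ) (τ h : ℝ) {d : ℕ} (m0 : (Fin d → ℤ) → ℝ)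
    (m : ℕ → (Fin d → ℤ) → ℝ) : Prop :=
  (∀ k ≤ K, ∀ j : Fin d → ℤ, isBoundary N j → m k j = 0) ∧
  (∀ k ≤ K, ∀ j : Fin d → ℤ, isGridPt N j → 0 ≤ m k j) ∧
  (∀ k, 1 ≤ k → k ≤ K → ∀ j : Fin d → ℤ, isInterior N j →
      (m k j - m (k - 1) j) / τ - discLap h (m k) j ≤ 0) ∧
  (∀ j : Fin d → ℤ, isGridPt N j → m 0 j = m0 j)

theorem obstacle_one_sided (d N K : ℕ) (τ h δ : ℝ) (hτ : 0 < τ) (hδ : 0 ≤ δ)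
    (f g u v : ℕ → (Fin d → ℤ) → ℝ)
    (hu : solvesObstacle N K τ h f u) (hv : solvesObstacle N K τ h g v)
    (hfg : ∀ k < K, ∀ j : Fin d → ℤ, isGridPt N j → f k j - g k j ≤ δ) :
    ∀ n k : ℕ, k + n = K → ∀ j : Fin d → ℤ, isGridPt N j →
      u k j - v k j ≤ n * (τ * δ) := by
  intro n
  induction n with
  | zero =>
    intro k hk j hj
    have hk' : k = K := by omega
    subst hk'
    rw [hu.2.1 j hj, hv.2.1 j hj]
    simp
  | succ n ih =>
    intro k hk j hj
    have hkK : k < K := by omega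
    have hτδ : 0 ≤ τ * δ := by positivity
    have hmem : ∀ j : Fin d → ℤ,
        j ∈ Fintype.piFinset (fun _ : Fin d => Finset.Icc (0 : ℤ) (N : ℤ)) ↔ isGridPt N j := by
      intro j
      simp [Fintype.mem_piFinset, isGridPt]
    obtain ⟨p, hp, hmax⟩ := Finset.exists_max_image
      (Fintype.piFinset (fun _ : Fin d => Finset.Icc (0 : ℤ) (N : ℤ)))
      (fun j => u k j - v k j) ⟨j, (hmem j).2 hj⟩
    have hp' := (hmem p).1 hp
    have hmax' : ∀ q, isGridPt N q → u k q - v k q ≤ u k p - v k p :=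
      fun q hq => hmax q ((hmem q).2 hq)
    refine (hmax' j hj).trans ?_
    have hnn : (0 : ℝ) ≤ ((n + 1 : ℕ) : ℝ) * (τ * δ) := by positivity
    by_cases hpos : u k p - v k p ≤ 0
    · exact hpos.trans hnn
    push Not at hpos
    have hint : isInterior N p := by
      by_contra hni
      rw [hu.2.2 k hkK p ⟨hp', hni⟩, hv.2.2 k hkK p ⟨hp', hni⟩] at hpos
      simp at hpos
    have h1 := hu.1 k hkK p hint
    have h2 := hv.1 k hkK p hint
    have hA := le_max_left ((u k p - u (k + 1) p) / τ - discLap h (u k) p - f k p) (u k p)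
    have hB := le_max_right ((u k p - u (k + 1) p) / τ - discLap h (u k) p - f k p) (u k p)
    rw [h1] at hA hB
    have hC : (v k p - v (k + 1) p) / τ - discLap h (v k) p - g k p = 0 := by
      rcases max_choice ((v k p - v (k + 1) p) / τ - discLap h (v k) p - g k p) (v k p) with e | e
      · rw [← e, h2]
      · rw [h2] at e
        linarith
    have hL : discLap h (u k) p - discLap h (v k) p ≤ 0 := by
      unfold discLap
      rw [← mul_sub, ← Finset.sum_sub_distrib]
      refine mul_nonpos_of_nonneg_of_nonpos (by positivity) (Finset.sum_nonpos ?_)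
      intro i _
      have ha : isGridPt N (p + Pi.single i 1) := by
        intro l
        have := hint l
        by_cases hl : l = i
        · subst hl
          simp
          omega
        · simp [hl]
          omega
      have hb : isGridPt N (p - Pi.single i 1) := by
        intro l
        have := hint l
        by_cases hl : l = i
        · subst hl
          simp
          omega
        · simp [hl]
          omega
      have := hmax' _ ha
      have := hmax' _ hb
      linarith
    have hF := hfg k hkK p hp'
    have hI := ih (k + 1) (by omega) p hp'
    have hD : ((u k p - v k p) - (u (k + 1) p - v (k + 1) p)) / τ ≤ δ := by
      have : ((u k p - v k p) - (u (k + 1) p - v (k + 1) p)) / τ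
          = (u k p - u (k + 1) p) / τ - (v k p - v (k + 1) p) / τ := by ring
      rw [this]
      linarith
    rw [div_le_iff₀ hτ] at hD
    push_cast
    linarith

/-- Continuous dependence of the implicit discrete obstacle problem on the source term
(Lemma 3.1): if `u` solves the problem with source `f`, then for every `ε > 0` there is `δ > 0`
such that any solution `u'` with source `f'` satisfying `max_{k,j}|f'^k_j − f^k_j| < δ`
satisfies `max_{k,j}|u'^k_j − u^k_j| < ε`. -/
theorem obstacle_continuous_dependence_on_source
    (d N K : ℕ) (hd : 1 ≤ d) (hN : 2 ≤ N) (hK : 1 ≤ K)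
    (τ h : ℝ) (hτ : 0 < τ) (hh : h = 1 / (N : ℝ))
    (f : ℕ → (Fin d → ℤ) → ℝ) (u : ℕ → (Fin d → ℤ) → ℝ)
    (hu : solvesObstacle N K τ h f u) :
    ∀ ε > 0, ∃ δ > 0, ∀ f' u' : ℕ → (Fin d → ℤ) → ℝ,
      solvesObstacle N K τ h f' u' →
      (∀ k < K, ∀ j : Fin d → ℤ, isGridPt N j → |f' k j - f k j| < δ) →
      ∀ k ≤ K, ∀ j : Fin d → ℤ, isGridPt N j → |u' k j - u k j| < ε := by
  intro ε hε
  have hK0 : (0 : ℝ) < K := by exact_mod_cast hK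
  have hδ : 0 < ε / (2 * K * τ) := by positivity
  refine ⟨ε / (2 * K * τ), hδ, ?_⟩
  intro f' u' hu' hff k hk j hj
  have h1 := obstacle_one_sided d N K τ h _ hτ hδ.le f' f u' u hu' hu
    (fun k hk j hj => (abs_lt.1 (hff k hk j hj)).2.le) (K - k) k (by omega) j hj
  have h2 := obstacle_one_sided d N K τ h _ hτ hδ.le f f' u u' hu hu'
    (fun k hk j hj => by linarith [(abs_lt.1 (hff k hk j hj)).1]) (K - k) k (by omega) j hj
  have h3 : ((K - k : ℕ) : ℝ) * (τ * (ε / (2 * K * τ))) ≤ ε / 2 := by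
    have h4 : ((K - k : ℕ) : ℝ) ≤ K := by exact_mod_cast Nat.sub_le K k
    calc ((K - k : ℕ) : ℝ) * (τ * (ε / (2 * K * τ)))
        ≤ K * (τ * (ε / (2 * K * τ))) := by gcongr
      _ = ε / 2 := by field_simp
  rw [abs_lt]
  constructor <;> linarith
end

section
/- Discrete best-response variational inequality (Step 1 of the proof of Theorem 3.2). Let m⁰ : Ω_h → ℝ satisfy m⁰_j ≥ 0 for all j and m⁰_j = 0 for every boundary point j. Let g : {0,...,K−1} × Ω_h → ℝ, let u solve the implicit discrete obstacle problem with source g, and let m' : {0,...,K} × Ω_h → ℝ satisfy m'^0 = m⁰, m'^k_j = 0 for every boundary j, and for every k ∈ {1,...,K} and interior j: (m'^k_j − m'^{k−1}_j)/τ − Δ_h m'^k(j) = 0 whenever u^k_j < 0, and m'^k_j = 0 whenever u^k_j = 0. Then for every m ∈ T_{h,τ}, Σ_{k=0}^{K−1} Σ_{j interior} g^k_j (m'^k_j − m^k_j) ≤ 0. -/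
theorem aux_mem (N d : ℕ) (j : Fin d → ℤ) : j ∈ intPts N d ↔ isInterior N j := by
  simp [intPts, isInterior, Fintype.mem_piFinset]

theorem aux_grid {N d : ℕ} {j : Fin d → ℤ} (hj : isInterior N j) : isGridPt N j := by
  intro i
  have := hj i
  constructor <;> omega

theorem aux_add {N d : ℕ} {j : Fin d → ℤ} (hj : isInterior N j) (i : Fin d) :
    isGridPt N (j + Pi.single i 1) := by
  intro l
  have := hj l
  by_cases hl : l = i
  · subst hl; simp; constructor <;> omega
  · simp [Pi.single_eq_of_ne hl]; constructor <;> omega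

theorem aux_sub {N d : ℕ} {j : Fin d → ℤ} (hj : isInterior N j) (i : Fin d) :
    isGridPt N (j - Pi.single i 1) := by
  intro l
  have := hj l
  by_cases hl : l = i
  · subst hl; simp; constructor <;> omega
  · simp [Pi.single_eq_of_ne hl]; constructor <;> omega

theorem aux_shift {N d : ℕ} (v w : (Fin d → ℤ) → ℝ)
    (hv : ∀ j, isBoundary N j → v j = 0) (hw : ∀ j, isBoundary N j → w j = 0) (i : Fin d) :
    ∑ j ∈ intPts N d, v (j + Pi.single i 1) * w j
      = ∑ j ∈ intPts N d, v j * w (j - Pi.single i 1) := by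
  refine Finset.sum_bij_ne_zero (fun j _ _ => j + Pi.single i 1) ?_ ?_ ?_ ?_
  · intro j hj hne
    rw [aux_mem] at hj ⊢
    by_contra hc
    exact hne (by rw [hv _ ⟨aux_add hj i, hc⟩, zero_mul])
  · intro a _ _ b _ _ hab
    exact add_right_cancel hab
  · intro j hj hne
    rw [aux_mem] at hj
    have hi : isInterior N (j - Pi.single i 1) := by
      by_contra hc
      exact hne (by rw [hw _ ⟨aux_sub hj i, hc⟩, mul_zero])
    refine ⟨j - Pi.single i 1, (aux_mem _ _ _).2 hi, ?_, by simp⟩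
    simpa using hne
  · intro j _ _
    simp

theorem aux_green {N d : ℕ} (h : ℝ) (v w : (Fin d → ℤ) → ℝ)
    (hv : ∀ j, isBoundary N j → v j = 0) (hw : ∀ j, isBoundary N j → w j = 0) :
    ∑ j ∈ intPts N d, discLap h v j * w j = ∑ j ∈ intPts N d, v j * discLap h w j := by
  have e1 : ∀ j, discLap h v j * w j = (1 / h ^ 2) * ∑ i : Fin d,
      (v (j + Pi.single i 1) * w j - 2 * (v j * w j) + w j * v (j - Pi.single i 1)) := by
    intro j
    rw [discLap, mul_assoc, Finset.sum_mul]
    congr 1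
    exact Finset.sum_congr rfl fun i _ => by ring
  have e2 : ∀ j, v j * discLap h w j = (1 / h ^ 2) * ∑ i : Fin d,
      (w (j + Pi.single i 1) * v j - 2 * (v j * w j) + v j * w (j - Pi.single i 1)) := by
    intro j
    rw [discLap, mul_left_comm, Finset.mul_sum]
    congr 1
    exact Finset.sum_congr rfl fun i _ => by ring
  simp_rw [e1, e2, ← Finset.mul_sum]
  congr 1
  rw [Finset.sum_comm, Finset.sum_comm (s := intPts N d)]
  refine Finset.sum_congr rfl fun i _ => ?_
  simp only [Finset.sum_add_distrib, Finset.sum_sub_distrib]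
  rw [aux_shift v w hv hw i, aux_shift w v hw hv i]
  ring

theorem aux_lap_sub {d : ℕ} (h : ℝ) (v w : (Fin d → ℤ) → ℝ) (j : Fin d → ℤ) :
    discLap h (fun j => v j - w j) j = discLap h v j - discLap h w j := by
  simp only [discLap]
  rw [← mul_sub, ← Finset.sum_sub_distrib]
  congr 1
  exact Finset.sum_congr rfl fun i _ => by ring

/-- Discrete best-response variational inequality (Step 1 of the proof of Theorem 3.2):
if `u` solves the implicit discrete obstacle problem with source `g` and `m'` is the associated
discrete Fokker–Planck best response, then `Σ_{k<K} Σ_{j interior} g^k_j (m'^k_j − m^k_j) ≤ 0`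
for every `m` in the discrete test set. -/
theorem discrete_best_response_variational_inequality
    (d N K : ℕ) (hd : 1 ≤ d) (hN : 2 ≤ N) (hK : 1 ≤ K)
    (τ h : ℝ) (hτ : 0 < τ) (hh : h = 1 / (N : ℝ))
    (m0 : (Fin d → ℤ) → ℝ)
    (hm0nonneg : ∀ j : Fin d → ℤ, isGridPt N j → 0 ≤ m0 j)
    (hm0bd : ∀ j : Fin d → ℤ, isBoundary N j → m0 j = 0)
    (g : ℕ → (Fin d → ℤ) → ℝ) (u m' : ℕ → (Fin d → ℤ) → ℝ)
    (hu : solvesObstacle N K τ h g u)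
    (hm'init : ∀ j : Fin d → ℤ, isGridPt N j → m' 0 j = m0 j)
    (hm'bd : ∀ k ≤ K, ∀ j : Fin d → ℤ, isBoundary N j → m' k j = 0)
    (hm'fp : ∀ k, 1 ≤ k → k ≤ K → ∀ j : Fin d → ℤ, isInterior N j →
      (u k j < 0 → (m' k j - m' (k - 1) j) / τ - discLap h (m' k) j = 0) ∧
      (u k j = 0 → m' k j = 0)) :
    ∀ m : ℕ → (Fin d → ℤ) → ℝ, inTestSet N K τ h m0 m →
      ∑ k ∈ Finset.range K, ∑ j ∈ intPts N d, g k j * (m' k j - m k j) ≤ 0 := by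
  intro m hm
  obtain ⟨hu1, hu2, hu3⟩ := hu
  obtain ⟨hmb, hmn, hms, hmi⟩ := hm
  have hw0 : ∀ j, isInterior N j → m' 0 j - m 0 j = 0 := fun j hj => by
    rw [hm'init j (aux_grid hj), hmi j (aux_grid hj), sub_self]
  have main : ∀ n, n < K →
      ∑ k ∈ Finset.range (n + 1), ∑ j ∈ intPts N d, g k j * (m' k j - m k j)
        ≤ - ∑ j ∈ intPts N d, u (n + 1) j * (m' n j - m n j) / τ := by
    intro n
    induction n with
    | zero =>
      intro _
      rw [Finset.sum_range_one, Finset.sum_eq_zero, Finset.sum_eq_zero]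
      · simp
      · intro j hj
        rw [aux_mem] at hj
        simp [hw0 j hj]
      · intro j hj
        rw [aux_mem] at hj
        simp [hw0 j hj]
    | succ n ih =>
      intro hn
      have ih := ih (by omega)
      rw [Finset.sum_range_succ]
      have green := aux_green (N := N) h (u (n + 1)) (fun j => m' (n + 1) j - m (n + 1) j)
        (hu3 (n + 1) hn) (fun j hj => by
          rw [hm'bd _ hn.le j hj, hmb _ hn.le j hj, sub_self])
      have key : ∑ j ∈ intPts N d, g (n + 1) j * (m' (n + 1) j - m (n + 1) j)
          ≤ ∑ j ∈ intPts N d, (u (n + 1) j * (m' n j - m n j) / τ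
            - u (n + 1 + 1) j * (m' (n + 1) j - m (n + 1) j) / τ
            + (u (n + 1) j * discLap h (fun j => m' (n + 1) j - m (n + 1) j) j
            - discLap h (u (n + 1)) j * (m' (n + 1) j - m (n + 1) j))) := by
        refine Finset.sum_le_sum fun j hj => ?_
        rw [aux_mem] at hj
        rw [aux_lap_sub]
        have hmax := hu1 (n + 1) hn j hj
        have hA := (le_max_left _ _).trans_eq hmax
        have hU := (le_max_right _ _).trans_eq hmax
        obtain ⟨hf1, hf2⟩ := hm'fp (n + 1) (by omega) hn.le j hj
        have hsub := hms (n + 1) (by omega) hn.le j hj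
        have hpos := hmn (n + 1) hn.le j (aux_grid hj)
        simp only [Nat.add_sub_cancel] at hf1 hsub
        rcases hU.lt_or_eq with hlt | heq
        · have hF := hf1 hlt
          have hAe : (u (n + 1) j - u (n + 1 + 1) j) / τ - discLap h (u (n + 1)) j
              - g (n + 1) j = 0 := by
            rcases max_choice ((u (n + 1) j - u (n + 1 + 1) j) / τ - discLap h (u (n + 1)) j
              - g (n + 1) j) (u (n + 1) j) with h1 | h1
            · rw [h1] at hmax; exact hmax
            · rw [h1] at hmax; exact absurd hmax hlt.ne
          have hg : g (n + 1) j
              = (u (n + 1) j - u (n + 1 + 1) j) / τ - discLap h (u (n + 1)) j := by linarith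
          have hp := mul_nonneg_of_nonpos_of_nonpos hU hsub
          have hL : discLap h (m' (n + 1)) j = (m' (n + 1) j - m' n j) / τ := by linarith
          rw [hg, hL]
          refine le_of_sub_nonneg (hp.trans_eq ?_)
          ring
        · rw [hf2 heq, heq]
          rw [heq] at hA
          have hp := mul_nonneg_of_nonpos_of_nonpos hA (neg_nonpos.2 hpos)
          refine le_of_sub_nonneg (hp.trans_eq ?_)
          ring
      rw [Finset.sum_add_distrib, Finset.sum_sub_distrib, Finset.sum_sub_distrib, green] at key
      linarith
  obtain ⟨n, rfl⟩ : ∃ n, K = n + 1 := ⟨K - 1, by omega⟩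
  refine (main n (by omega)).trans_eq ?_
  rw [Finset.sum_eq_zero, neg_zero]
  intro j hj
  rw [aux_mem] at hj
  rw [hu2 j (aux_grid hj)]
  simp
end

section
/- Discrete comparison principle: elements of the discrete test set are dominated by the implicit heat solution (discrete analogue of the bound ‖m‖ ≤ ‖m̃‖ used in the proofs of Theorems 3.1 and 3.2). Let m⁰ : Ω_h → ℝ satisfy m⁰_j ≥ 0 for all j and m⁰_j = 0 for every boundary point j. Let m̃ : {0,...,K} × Ω_h → ℝ satisfy m̃^0 = m⁰, m̃^k_j = 0 for every boundary j, and (m̃^k_j − m̃^{k−1}_j)/τ − Δ_h m̃^k(j) = 0 for every k ∈ {1,...,K} and every interior j. Then every m ∈ T_{h,τ} satisfies 0 ≤ m^k_j ≤ m̃^k_j for all k ∈ {0,...,K} and j ∈ Ω_h; in particular, (τ h Σ_{k=0}^{K−1} Σ_{j interior} (m^k_j)²)^{1/2} ≤ (τ h Σ_{k=0}^{K−1} Σ_{j interior} (m̃^k_j)²)^{1/2}. -/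
lemma discLap_le_zero_of_max (N : ℕ) (h : ℝ) {d : ℕ} (v w : (Fin d → ℤ) → ℝ) (j : Fin d → ℤ)
    (hj : isInterior N j)
    (hmax : ∀ i : Fin d → ℤ, isGridPt N i → v i - w i ≤ v j - w j) :
    discLap h v j ≤ discLap h w j := by
  unfold discLap
  apply mul_le_mul_of_nonneg_left _ (by positivity)
  apply Finset.sum_le_sum
  intro i _
  have h1 : isGridPt N (j + Pi.single i 1) := by
    intro a
    have := hj a
    by_cases hai : a = i
    · subst hai; simp; omega
    · simp [hai]; omega
  have h2 : isGridPt N (j - Pi.single i 1) := by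
    intro a
    have := hj a
    by_cases hai : a = i
    · subst hai; simp; omega
    · simp [hai]; omega
  have := hmax _ h1
  have := hmax _ h2
  linarith

/-- Discrete comparison principle: every element of the discrete test set `T_{h,τ}` is dominated
pointwise (hence in the discrete `L²` norm) by the solution `m̃` of the implicit heat scheme with
the same initial datum. -/
theorem discrete_test_set_dominated_by_implicit_heat_solution
    (d N K : ℕ) (hd : 1 ≤ d) (hN : 2 ≤ N) (hK : 1 ≤ K)
    (τ h : ℝ) (hτ : 0 < τ) (hh : h = 1 / (N : ℝ))
    (m0 : (Fin d → ℤ) → ℝ)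
    (hm0nonneg : ∀ j : Fin d → ℤ, isGridPt N j → 0 ≤ m0 j)
    (hm0bd : ∀ j : Fin d → ℤ, isBoundary N j → m0 j = 0)
    (mt : ℕ → (Fin d → ℤ) → ℝ)
    (hmtinit : ∀ j : Fin d → ℤ, isGridPt N j → mt 0 j = m0 j)
    (hmtbd : ∀ k ≤ K, ∀ j : Fin d → ℤ, isBoundary N j → mt k j = 0)
    (hmtheat : ∀ k, 1 ≤ k → k ≤ K → ∀ j : Fin d → ℤ, isInterior N j →
      (mt k j - mt (k - 1) j) / τ - discLap h (mt k) j = 0) :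
    ∀ m : ℕ → (Fin d → ℤ) → ℝ, inTestSet N K τ h m0 m →
      (∀ k ≤ K, ∀ j : Fin d → ℤ, isGridPt N j → 0 ≤ m k j ∧ m k j ≤ mt k j) ∧
      Real.sqrt (τ * h * ∑ k ∈ Finset.range K, ∑ j ∈ intPts N d, m k j ^ 2) ≤
        Real.sqrt (τ * h * ∑ k ∈ Finset.range K, ∑ j ∈ intPts N d, mt k j ^ 2) := by
  intro m hm
  obtain ⟨hbd, hnn, hsub, hinit⟩ := hm
  have key : ∀ k ≤ K, ∀ j : Fin d → ℤ, isGridPt N j → m k j ≤ mt k j := by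
    intro k
    induction k with
    | zero =>
      intro _ j hj
      rw [hinit j hj, hmtinit j hj]
    | succ k ih =>
      intro hk j hj
      have ih' := ih (by omega)
      let S : Finset (Fin d → ℤ) := Fintype.piFinset fun _ : Fin d => Finset.Icc (0 : ℤ) (N : ℤ)
      have hS : ∀ i : Fin d → ℤ, i ∈ S ↔ isGridPt N i := by
        intro i
        simp [S, isGridPt, Fintype.mem_piFinset]
      obtain ⟨p, hpS, hp⟩ := Finset.exists_max_image S (fun i => m (k + 1) i - mt (k + 1) i)
        ⟨j, (hS j).2 hj⟩
      have hpG := (hS p).1 hpS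
      have hle : m (k + 1) p - mt (k + 1) p ≤ 0 := by
        by_cases hpi : isInterior N p
        · have h1 := hsub (k + 1) (by omega) hk p hpi
          have h2 := hmtheat (k + 1) (by omega) hk p hpi
          have h3 := discLap_le_zero_of_max N h (m (k + 1)) (mt (k + 1)) p hpi
            (fun i hi => hp i ((hS i).2 hi))
          have h4 := ih' p hpG
          simp only [Nat.add_sub_cancel] at h1 h2
          have h5 : (m (k + 1) p - m k p) / τ ≤ (mt (k + 1) p - mt k p) / τ := by linarith
          rw [div_le_div_iff_of_pos_right hτ] at h5
          linarith
        · rw [hbd _ hk p ⟨hpG, hpi⟩, hmtbd _ hk p ⟨hpG, hpi⟩]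
          simp
      have := hp j ((hS j).2 hj)
      linarith
  refine ⟨fun k hk j hj => ⟨hnn k hk j hj, key k hk j hj⟩, ?_⟩
  apply Real.sqrt_le_sqrt
  have hh0 : 0 ≤ h := by rw [hh]; positivity
  apply mul_le_mul_of_nonneg_left _ (by positivity)
  apply Finset.sum_le_sum
  intro k hk
  apply Finset.sum_le_sum
  intro j hj
  have hkK : k ≤ K := (Finset.mem_range.1 hk).le
  have hjG : isGridPt N j := by
    intro i
    have := Finset.mem_Icc.1 (Fintype.mem_piFinset.1 hj i)
    omega
  exact pow_le_pow_left₀ (hnn k hkK j hjG) (key k hkK j hjG) 2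
end

section
/- Inverse positivity of the implicit heat step. If v : Ω_h → ℝ vanishes at every boundary point of Ω_h and satisfies v_j − τ Δ_h v(j) ≥ 0 for every interior point j, then v_j ≥ 0 for every j ∈ Ω_h. -/
/-- Inverse positivity of the implicit heat step: if `v` vanishes at every boundary point and
`v_j − τ Δ_h v(j) ≥ 0` at every interior point, then `v ≥ 0` on the whole grid. -/
theorem implicit_heat_step_inverse_positivity
    (d N K : ℕ) (hd : 1 ≤ d) (hN : 2 ≤ N) (hK : 1 ≤ K)
    (τ h : ℝ) (hτ : 0 < τ) (hh : h = 1 / (N : ℝ))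
    (v : (Fin d → ℤ) → ℝ)
    (hbd : ∀ j : Fin d → ℤ, isBoundary N j → v j = 0)
    (hpos : ∀ j : Fin d → ℤ, isInterior N j → 0 ≤ v j - τ * discLap h v j) :
    ∀ j : Fin d → ℤ, isGridPt N j → 0 ≤ v j := by
  intro j hj
  have hmem : ∀ x : Fin d → ℤ,
      x ∈ (Fintype.piFinset fun _ : Fin d => Finset.Icc (0 : ℤ) (N : ℤ)) ↔ isGridPt N x := by
    intro x
    simp [Fintype.mem_piFinset, isGridPt]
  obtain ⟨m, hm, hmin⟩ := Finset.exists_min_image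
    (Fintype.piFinset fun _ : Fin d => Finset.Icc (0 : ℤ) (N : ℤ)) v ⟨j, (hmem j).2 hj⟩
  have hmg := (hmem m).1 hm
  refine le_trans ?_ (hmin j ((hmem j).2 hj))
  by_contra hneg
  push Not at hneg
  have hint : isInterior N m := by
    by_contra hni
    have := hbd m ⟨hmg, hni⟩
    linarith
  have hlap : 0 ≤ discLap h v m := by
    unfold discLap
    refine mul_nonneg (by positivity) (Finset.sum_nonneg fun i _ => ?_)
    have h1 : v m ≤ v (m + Pi.single i 1) := by
      refine hmin _ ((hmem _).2 fun k => ?_)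
      have := hint k
      by_cases hk : k = i
      · subst hk
        simp only [Pi.add_apply, Pi.single_eq_same]
        omega
      · simp only [Pi.add_apply, Pi.single_eq_of_ne hk]
        omega
    have h2 : v m ≤ v (m - Pi.single i 1) := by
      refine hmin _ ((hmem _).2 fun k => ?_)
      have := hint k
      by_cases hk : k = i
      · subst hk
        simp only [Pi.sub_apply, Pi.single_eq_same]
        omega
      · simp only [Pi.sub_apply, Pi.single_eq_of_ne hk]
        omega
    linarith
  have h3 := hpos m hint
  have h4 := mul_nonneg hτ.le hlap
  linarith
end

section
/- Invertibility of the mixed obstacle/heat linear systems arising in the proof of Lemma 3.1. For every subset S of the set of interior points of Ω_h, the linear map Ψ_S from the vector space {v : Ω_h → ℝ : v vanishes at every boundary point} to the vector space of real-valued functions on the interior points, defined by Ψ_S(v)(j) = v_j for j ∈ S and Ψ_S(v)(j) = v_j − τ Δ_h v(j) for interior points j ∉ S, is a linear bijection. -/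
/-- The space of grid functions supported on interior points, i.e. functions `v : Ω_h → ℝ`
(extended by zero off the grid) that vanish at every boundary point. -/
def dirichletSpace (N d : ℕ) : Submodule ℝ ((Fin d → ℤ) → ℝ) where
  carrier := {v | ∀ j : Fin d → ℤ, ¬ isInterior N j → v j = 0}
  add_mem' := by
    intro a b ha hb j hj
    simp [ha j hj, hb j hj]
  zero_mem' := by
    intro j hj
    rfl
  smul_mem' := by
    intro c a ha j hj
    simp [ha j hj]

theorem mohs_nonpos {d N : ℕ} (τ h : ℝ) (hτ : 0 < τ) (S : Set (Fin d → ℤ))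
    (v : (Fin d → ℤ) → ℝ) (hv : ∀ j, ¬ isInterior N j → v j = 0)
    (h1 : ∀ j, isInterior N j → j ∈ S → v j = 0)
    (h2 : ∀ j, isInterior N j → j ∉ S → v j - τ * discLap h v j = 0) (k : Fin d → ℤ) :
    v k ≤ 0 := by
  by_contra! hk
  have hmem : ∀ j : Fin d → ℤ, j ∈ intPts N d ↔ isInterior N j := by
    intro j
    simp [intPts, isInterior]
  have hki : isInterior N k := by
    by_contra hc
    linarith [hv k hc]
  obtain ⟨j, hj, hmax⟩ := Finset.exists_max_image (intPts N d) v ⟨k, (hmem k).2 hki⟩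
  have hjk := hmax k ((hmem k).2 hki)
  have hall : ∀ l, v l ≤ v j := by
    intro l
    by_cases hl : isInterior N l
    · exact hmax l ((hmem l).2 hl)
    · rw [hv l hl]; linarith
  have hji := (hmem j).1 hj
  by_cases hjS : j ∈ S
  · linarith [h1 j hji hjS]
  · have h3 := h2 j hji hjS
    have h4 : discLap h v j ≤ 0 := by
      unfold discLap
      apply mul_nonpos_of_nonneg_of_nonpos (by positivity)
      apply Finset.sum_nonpos
      intro i _
      linarith [hall (j + Pi.single i 1), hall (j - Pi.single i 1)]
    have h5 := mul_nonpos_of_nonneg_of_nonpos hτ.le h4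
    linarith

theorem discLap_add' (h : ℝ) {d : ℕ} (v w : (Fin d → ℤ) → ℝ) (j : Fin d → ℤ) :
    discLap h (v + w) j = discLap h v j + discLap h w j := by
  unfold discLap
  rw [← mul_add, ← Finset.sum_add_distrib]
  congr 1
  apply Finset.sum_congr rfl
  intro i _
  simp only [Pi.add_apply]
  ring

theorem discLap_smul' (h : ℝ) {d : ℕ} (c : ℝ) (v : (Fin d → ℤ) → ℝ) (j : Fin d → ℤ) :
    discLap h (c • v) j = c * discLap h v j := by
  unfold discLap
  rw [mul_left_comm, Finset.mul_sum Finset.univ _ c]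
  congr 1
  apply Finset.sum_congr rfl
  intro i _
  simp only [Pi.smul_apply, smul_eq_mul]
  ring

open scoped Classical in
/-- Restriction to interior points. -/
noncomputable def mohsEquiv (N d : ℕ) :
    dirichletSpace N d ≃ₗ[ℝ] ({j : Fin d → ℤ // isInterior N j} → ℝ) where
  toFun v j := v.1 j
  map_add' _ _ := rfl
  map_smul' _ _ := rfl
  invFun f := ⟨fun j => if hj : isInterior N j then f ⟨j, hj⟩ else 0, by
    intro j hj
    simp [hj]⟩
  left_inv := by
    intro v
    ext j
    by_cases hj : isInterior N j
    · simp [hj]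
    · simp [hj, v.2 j hj]
  right_inv := by
    intro f
    ext j
    simp [j.2]

open scoped Classical in
/-- Invertibility of the mixed obstacle/heat linear systems arising in the proof of Lemma 3.1:
for every set `S` of interior points, the linear map `Ψ_S` sending a Dirichlet grid function `v`
to the interior grid function `j ↦ v_j` (for `j ∈ S`) and `j ↦ v_j − τ Δ_h v(j)` (for `j ∉ S`)
is a linear bijection. -/
theorem mixed_obstacle_heat_system_invertible
    (d N K : ℕ) (hd : 1 ≤ d) (hN : 2 ≤ N) (hK : 1 ≤ K)
    (τ h : ℝ) (hτ : 0 < τ) (hh : h = 1 / (N : ℝ))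
    (S : Set (Fin d → ℤ)) (hS : ∀ j ∈ S, isInterior N j) :
    ∃ Ψ : dirichletSpace N d →ₗ[ℝ] ({j : Fin d → ℤ // isInterior N j} → ℝ),
      (∀ (v : dirichletSpace N d) (j : {j : Fin d → ℤ // isInterior N j}),
        Ψ v j = if (j : Fin d → ℤ) ∈ S then v.1 j else v.1 j - τ * discLap h v.1 j) ∧
      Function.Bijective Ψ := by
  let Ψ : dirichletSpace N d →ₗ[ℝ] ({j : Fin d → ℤ // isInterior N j} → ℝ) :=
    { toFun := fun v j => if (j : Fin d → ℤ) ∈ S then v.1 j else v.1 j - τ * discLap h v.1 j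
      map_add' := by
        intro v w
        ext j
        simp only [Submodule.coe_add, Pi.add_apply, discLap_add']
        split_ifs <;> ring
      map_smul' := by
        intro c v
        ext j
        simp only [Submodule.coe_smul, Pi.smul_apply, discLap_smul', smul_eq_mul,
          RingHom.id_apply]
        split_ifs <;> ring }
  have hΨ : ∀ (v : dirichletSpace N d) (j : {j : Fin d → ℤ // isInterior N j}),
      Ψ v j = if (j : Fin d → ℤ) ∈ S then v.1 j else v.1 j - τ * discLap h v.1 j :=
    fun _ _ => rfl
  have hle : ∀ v : dirichletSpace N d, Ψ v = 0 → ∀ k, v.1 k ≤ 0 := by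
    intro v hv k
    refine mohs_nonpos (N := N) τ h hτ S v.1 v.2 ?_ ?_ k
    · intro j hj hjS
      have := congrFun hv ⟨j, hj⟩
      rw [hΨ] at this
      simpa [hjS] using this
    · intro j hj hjS
      have := congrFun hv ⟨j, hj⟩
      rw [hΨ] at this
      simpa only [hjS, if_false, Pi.zero_apply] using this
  have hinj : Function.Injective Ψ := by
    rw [injective_iff_map_eq_zero]
    intro v hv
    have a := hle v hv
    have b := hle (-v) (by rw [map_neg, hv, neg_zero])
    ext k
    have bk := b k
    simp only [Submodule.coe_neg, Pi.neg_apply] at bk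
    simp only [Submodule.coe_zero, Pi.zero_apply]
    linarith [a k]
  haveI : Finite {j : Fin d → ℤ // isInterior N j} := by
    refine Set.Finite.to_subtype (s := {j : Fin d → ℤ | isInterior N j})
      ((intPts N d).finite_toSet.subset ?_)
    intro j hj
    exact Finset.mem_coe.2 (Fintype.mem_piFinset.2 fun i => Finset.mem_Icc.2 (hj i))
  haveI : FiniteDimensional ℝ (dirichletSpace N d) :=
    Module.Finite.equiv (mohsEquiv N d).symm
  exact ⟨Ψ, hΨ, hinj, (LinearMap.injective_iff_surjective_of_finrank_eq_finrank
    (mohsEquiv N d).finrank_eq).1 hinj⟩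
end
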